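/- For the interpolating function A(t) = N⁻¹ E log Σ_{σ,τ} exp(√t·β√(2/N)Σ_{ij}ξ_{ij}σᵢτⱼ + √(1−t)[β√(2(1-α)p̄)Σᵢηᵢσᵢ + β√(2αq̄)Σⱼη̃ⱼτⱼ]) + (1−t)α(1-α)β²(1−q̄)(1−p̄), with ξ, η, η̃ independent standard Gaussians, the t-derivative equals dA/dt = −α(1-α)β² ⟨(q̄ − q₁₂)(p̄ − p₁₂)⟩_t, where ⟨·⟩_t is the quenched two-replica average at interpolation parameter t. Consequently, for any t, A(1) = A(0) − α(1-α)β² ∫₀¹ ⟨(q̄−q₁₂)(p̄−p₁₂)⟩_t dt (sum rule), so if the fluctuation term vanishes the pressure equals the replica-symmetric trial pressure. -/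

import Mathlib

open MeasureTheory ProbabilityTheory

noncomputable def spin (b : Bool) : ℝ := if b then 1 else -1

noncomputable def overlap {K : ℕ} (σ σ' : Fin K → Bool) : ℝ :=
  (∑ i, spin (σ i) * spin (σ' i)) / K

/-- Disorder index: the couplings ξ_{ij}, plus the perturbations η_i and η̃_j. -/
abbrev DisIdx (N₁ N₂ : ℕ) := (Fin N₁ × Fin N₂) ⊕ (Fin N₁ ⊕ Fin N₂)

/-- Product standard Gaussian measure on the disorder. -/
noncomputable def disMeasure (N₁ N₂ : ℕ) : Measure (DisIdx N₁ N₂ → ℝ) :=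
  Measure.pi fun _ => gaussianReal 0 1

/-- Exponent of the interpolating Boltzmann factor at interpolation parameter `t`. -/
noncomputable def interpExp (N₁ N₂ : ℕ) (β qbar pbar t : ℝ) (ω : DisIdx N₁ N₂ → ℝ)
    (σ : Fin N₁ → Bool) (τ : Fin N₂ → Bool) : ℝ :=
  Real.sqrt t * β * Real.sqrt (2 / ((N₁ : ℝ) + N₂)) *
      (∑ i : Fin N₁, ∑ j : Fin N₂, ω (Sum.inl (i, j)) * spin (σ i) * spin (τ j))
    + Real.sqrt (1 - t) *
      (β * Real.sqrt (2 * (1 - (N₁ : ℝ) / ((N₁ : ℝ) + N₂)) * pbar) *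
          (∑ i : Fin N₁, ω (Sum.inr (Sum.inl i)) * spin (σ i))
        + β * Real.sqrt (2 * ((N₁ : ℝ) / ((N₁ : ℝ) + N₂)) * qbar) *
          (∑ j : Fin N₂, ω (Sum.inr (Sum.inr j)) * spin (τ j)))

/-- Interpolating partition function. -/
noncomputable def interpZ (N₁ N₂ : ℕ) (β qbar pbar t : ℝ) (ω : DisIdx N₁ N₂ → ℝ) : ℝ :=
  ∑ σ : Fin N₁ → Bool, ∑ τ : Fin N₂ → Bool, Real.exp (interpExp N₁ N₂ β qbar pbar t ω σ τ)

/-- Two-replica Gibbs expectation of `(qbar - q₁₂)(pbar - p₁₂)` at fixed disorder. -/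
noncomputable def fluctGibbs (N₁ N₂ : ℕ) (β qbar pbar t : ℝ) (ω : DisIdx N₁ N₂ → ℝ) : ℝ :=
  (∑ σ₁ : Fin N₁ → Bool, ∑ τ₁ : Fin N₂ → Bool, ∑ σ₂ : Fin N₁ → Bool, ∑ τ₂ : Fin N₂ → Bool,
      (qbar - overlap σ₁ σ₂) * (pbar - overlap τ₁ τ₂) *
        Real.exp (interpExp N₁ N₂ β qbar pbar t ω σ₁ τ₁
          + interpExp N₁ N₂ β qbar pbar t ω σ₂ τ₂))
    / (interpZ N₁ N₂ β qbar pbar t ω) ^ 2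

/-- The interpolating quenched pressure. -/
noncomputable def interpA (N₁ N₂ : ℕ) (β qbar pbar t : ℝ) : ℝ :=
  (1 / ((N₁ : ℝ) + N₂)) *
      ∫ ω, Real.log (interpZ N₁ N₂ β qbar pbar t ω) ∂(disMeasure N₁ N₂)
    + (1 - t) * ((N₁ : ℝ) / ((N₁ : ℝ) + N₂)) * (1 - (N₁ : ℝ) / ((N₁ : ℝ) + N₂)) * β ^ 2 *
        (1 - qbar) * (1 - pbar)

open Filter Topology

section GaussianIntegrationByParts

theorem hasDerivAt_gaussianPDFReal_zero_one (x : ℝ) :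
    HasDerivAt (gaussianPDFReal 0 1) (-x * gaussianPDFReal 0 1 x) x := by
  have h1 : HasDerivAt (fun y : ℝ => -(y - 0) ^ 2 / (2 * ((1 : NNReal) : ℝ))) (-x) x := by
    have h := (((hasDerivAt_id x).sub_const 0).pow 2).neg.div_const (2 * ((1 : NNReal) : ℝ))
    refine h.congr_deriv ?_
    simp
    ring
  have h2 := h1.exp.const_mul (√(2 * Real.pi * ((1 : NNReal) : ℝ)))⁻¹
  rw [gaussianPDFReal_def]
  exact h2.congr_deriv (by ring)

theorem integrable_mul_of_bounded {Ω : Type*} [MeasurableSpace Ω] {μ : Measure Ω} {f g : Ω → ℝ}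
    {C : ℝ} (hf : Integrable f μ) (hg : Measurable g) (hgC : ∀ x, |g x| ≤ C) :
    Integrable (fun x => f x * g x) μ :=
  hf.mul_bdd (c := C) hg.aestronglyMeasurable (ae_of_all _ hgC)

theorem integrable_gaussianReal_iff {f : ℝ → ℝ} :
    Integrable f (gaussianReal 0 1) ↔ Integrable (fun x => gaussianPDFReal 0 1 x * f x) := by
  rw [gaussianReal_of_var_ne_zero 0 one_ne_zero,
    integrable_withDensity_iff_integrable_smul' (measurable_gaussianPDF _ _)
      (ae_of_all _ fun _ => gaussianPDF_lt_top)]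
  simp

theorem integrable_id_gaussianReal (μ : ℝ) (v : NNReal) :
    Integrable (fun x : ℝ => x) (gaussianReal μ v) :=
  memLp_one_iff_integrable.1 (memLp_id_gaussianReal' 1 (by simp))

/-- Gaussian integration by parts on the line. -/
theorem integral_id_mul_gaussianReal {f f' : ℝ → ℝ} {C D : ℝ}
    (hf : ∀ x, HasDerivAt f (f' x) x) (hfm : Measurable f) (hf'm : Measurable f')
    (hC : ∀ x, |f x| ≤ C) (hD : ∀ x, |f' x| ≤ D) :
    ∫ x, x * f x ∂(gaussianReal 0 1) = ∫ x, f' x ∂(gaussianReal 0 1) := by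
  have hid := integrable_gaussianReal_iff.1
    (integrable_mul_of_bounded (integrable_id_gaussianReal 0 1) hfm hC)
  have h := integral_mul_deriv_eq_deriv_mul_of_integrable (u := f)
    (v := gaussianPDFReal 0 1) (u' := f') (v' := fun x => -x * gaussianPDFReal 0 1 x)
    (fun x _ => hf x) (fun x _ => hasDerivAt_gaussianPDFReal_zero_one x)
    (hid.neg.congr (ae_of_all _ fun x => by simp; ring))
    ((integrable_mul_of_bounded (integrable_gaussianPDFReal 0 1) hf'm hD).congr
      (ae_of_all _ fun x => by simp; ring))
    ((integrable_mul_of_bounded (integrable_gaussianPDFReal 0 1) hfm hC).congr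
      (ae_of_all _ fun x => by simp; ring))
  rw [integral_gaussianReal_eq_integral_smul one_ne_zero,
    integral_gaussianReal_eq_integral_smul one_ne_zero]
  have h1 : ∫ x, f x * (-x * gaussianPDFReal 0 1 x)
      = -∫ x, gaussianPDFReal 0 1 x • (x * f x) := by
    rw [← integral_neg]
    congr 1 with x
    simp only [smul_eq_mul]
    ring
  have h2 : ∫ x, f' x * gaussianPDFReal 0 1 x = ∫ x, gaussianPDFReal 0 1 x • f' x := by
    congr 1 with x
    simp only [smul_eq_mul]
    ring
  rw [h1, h2] at h
  exact neg_injective h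

/-- Resampling one coordinate of a product probability measure leaves it invariant. -/
theorem measurePreserving_update {ι : Type*} [Fintype ι] [DecidableEq ι] {X : ι → Type*}
    [∀ i, MeasurableSpace (X i)]
    (μ : ∀ i, Measure (X i)) [∀ i, IsProbabilityMeasure (μ i)] (k : ι) :
    MeasurePreserving (fun p : (∀ i, X i) × X k => Function.update p.1 k p.2)
      ((Measure.pi μ).prod (μ k)) (Measure.pi μ) := by
  have hm : Measurable (fun p : (∀ i, X i) × X k => Function.update p.1 k p.2) := by
    refine measurable_pi_lambda _ fun i => ?_
    by_cases h : i = k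
    · subst h
      simpa using measurable_snd
    · simp only [Function.update_of_ne h]
      exact (measurable_pi_apply i).comp measurable_fst
  refine ⟨hm, (Measure.pi_eq fun s hs => ?_).symm⟩
  rw [Measure.map_apply hm (MeasurableSet.univ_pi hs)]
  have hset : (fun p : (∀ i, X i) × X k => Function.update p.1 k p.2) ⁻¹' Set.univ.pi s
      = (Set.univ.pi (Function.update s k Set.univ)) ×ˢ s k := by
    ext p
    simp only [Set.mem_preimage, Set.mem_univ_pi, Set.mem_prod]
    constructor
    · refine fun h => ⟨fun i => ?_, by simpa using h k⟩
      by_cases hi : i = k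
      · subst hi; simp
      · simpa [Function.update_of_ne hi] using h i
    · rintro ⟨h, h'⟩ i
      by_cases hi : i = k
      · subst hi; simpa using h'
      · simpa [Function.update_of_ne hi] using h i
  rw [hset, Measure.prod_prod, Measure.pi_pi,
    ← Finset.mul_prod_erase Finset.univ _ (Finset.mem_univ k),
    ← Finset.mul_prod_erase Finset.univ (fun i => μ i (s i)) (Finset.mem_univ k)]
  simp only [Function.update_self, measure_univ, one_mul]
  rw [mul_comm]
  congr 1
  refine Finset.prod_congr rfl fun i hi => ?_
  rw [Function.update_of_ne (Finset.ne_of_mem_erase hi)]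

theorem integrable_eval_pi_gaussianReal {ι : Type*} [Fintype ι] (k : ι) :
    Integrable (fun ω : ι → ℝ => ω k) (Measure.pi fun _ => gaussianReal 0 1) :=
  (measurePreserving_eval (fun _ : ι => gaussianReal 0 1) k).integrable_comp_of_integrable
    (integrable_id_gaussianReal 0 1)

/-- Gaussian integration by parts (Wick's theorem) for a standard Gaussian vector. -/
theorem integral_eval_mul_pi_gaussianReal {ι : Type*} [Fintype ι] [DecidableEq ι]
    (k : ι) {g g' : (ι → ℝ) → ℝ} {C D : ℝ}
    (hg : ∀ ω x, HasDerivAt (fun y => g (Function.update ω k y)) (g' (Function.update ω k x)) x)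
    (hgm : Measurable g) (hg'm : Measurable g') (hC : ∀ ω, |g ω| ≤ C) (hD : ∀ ω, |g' ω| ≤ D) :
    ∫ ω, ω k * g ω ∂(Measure.pi fun _ => gaussianReal 0 1)
      = ∫ ω, g' ω ∂(Measure.pi fun _ => gaussianReal 0 1) := by
  have hmp := measurePreserving_update (fun _ : ι => gaussianReal 0 1) k
  have hint : Integrable (fun ω : ι → ℝ => ω k * g ω) (Measure.pi fun _ => gaussianReal 0 1) :=
    integrable_mul_of_bounded (integrable_eval_pi_gaussianReal k) hgm hC
  have hint' : Integrable g' (Measure.pi fun _ : ι => gaussianReal 0 1) :=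
    Integrable.of_bound hg'm.aestronglyMeasurable D (ae_of_all _ hD)
  have hres : ∀ F : (ι → ℝ) → ℝ, Integrable F (Measure.pi fun _ => gaussianReal 0 1) →
      ∫ ω, F ω ∂(Measure.pi fun _ => gaussianReal 0 1)
        = ∫ ω, ∫ x, F (Function.update ω k x) ∂(gaussianReal 0 1)
            ∂(Measure.pi fun _ => gaussianReal 0 1) := by
    intro F hF
    rw [← integral_prod (fun p : (ι → ℝ) × ℝ => F (Function.update p.1 k p.2))
      (hmp.integrable_comp_of_integrable hF)]
    conv_lhs => rw [← hmp.map_eq]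
    exact integral_map hmp.measurable.aemeasurable (by rw [hmp.map_eq]; exact hF.1)
  rw [hres _ hint, hres _ hint']
  congr 1 with ω
  simp only [Function.update_self]
  have hu : Measurable fun x : ℝ => Function.update ω k x := measurable_update ω
  exact integral_id_mul_gaussianReal (hg ω) (hgm.comp hu) (hg'm.comp hu)
    (fun _ => hC _) (fun _ => hD _)

end GaussianIntegrationByParts

section GibbsMeasure

variable {S : Type*} [Fintype S]

/-- Partition function of the (signed) energy `E` on a finite configuration space. -/
noncomputable def partitionFn (E : S → ℝ) : ℝ := ∑ s, Real.exp (E s)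

/-- Gibbs average of the observable `f` for the Boltzmann weights `exp (E s)`. -/
noncomputable def gibbsMean (E f : S → ℝ) : ℝ := (∑ s, f s * Real.exp (E s)) / partitionFn E

theorem partitionFn_pos [Nonempty S] (E : S → ℝ) : 0 < partitionFn E :=
  Finset.sum_pos (fun _ _ => Real.exp_pos _) Finset.univ_nonempty

theorem continuous_partitionFn : Continuous (partitionFn (S := S)) := by
  unfold partitionFn
  fun_prop

theorem continuous_gibbsMean [Nonempty S] (f : S → ℝ) : Continuous fun E => gibbsMean E f :=
  Continuous.div (by fun_prop) continuous_partitionFn fun E => (partitionFn_pos E).ne'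

theorem abs_gibbsMean_le [Nonempty S] {E f : S → ℝ} {C : ℝ} (hf : ∀ s, |f s| ≤ C) :
    |gibbsMean E f| ≤ C := by
  rw [gibbsMean, abs_div, abs_of_pos (partitionFn_pos E), div_le_iff₀ (partitionFn_pos E),
    partitionFn, Finset.mul_sum]
  refine (Finset.abs_sum_le_sum_abs _ _).trans (Finset.sum_le_sum fun s _ => ?_)
  rw [abs_mul, Real.abs_exp]
  exact mul_le_mul_of_nonneg_right (hf s) (Real.exp_pos _).le

theorem abs_le_sum_abs (f : S → ℝ) (s : S) : |f s| ≤ ∑ s', |f s'| :=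
  Finset.single_le_sum (f := fun s' => |f s'|) (fun _ _ => abs_nonneg _) (Finset.mem_univ s)

theorem gibbsMean_const [Nonempty S] (E : S → ℝ) (c : ℝ) : gibbsMean E (fun _ => c) = c := by
  rw [gibbsMean, ← Finset.mul_sum]
  exact mul_div_cancel_right₀ c (partitionFn_pos E).ne'

theorem gibbsMean_const_mul (E f : S → ℝ) (c : ℝ) :
    gibbsMean E (fun s => c * f s) = c * gibbsMean E f := by
  simp only [gibbsMean, mul_assoc, ← Finset.mul_sum, mul_div_assoc]

theorem gibbsMean_add (E f g : S → ℝ) :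
    gibbsMean E (fun s => f s + g s) = gibbsMean E f + gibbsMean E g := by
  simp only [gibbsMean, add_mul, Finset.sum_add_distrib, add_div]

theorem gibbsMean_sum {κ : Type*} (A : Finset κ) (E : S → ℝ) (f : κ → S → ℝ) :
    gibbsMean E (fun s => ∑ k ∈ A, f k s) = ∑ k ∈ A, gibbsMean E (f k) := by
  simp only [gibbsMean, ← Finset.sum_div, Finset.sum_mul]
  rw [Finset.sum_comm]

theorem partitionFn_replicas (E : S → ℝ) :
    partitionFn (fun p : S × S => E p.1 + E p.2) = partitionFn E ^ 2 := by
  simp only [partitionFn, Fintype.sum_prod_type, Real.exp_add, sq, Finset.sum_mul_sum]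

/-- A product of Gibbs averages is a two-replica Gibbs average. -/
theorem gibbsMean_mul_gibbsMean (E f g : S → ℝ) :
    gibbsMean E f * gibbsMean E g
      = gibbsMean (fun p : S × S => E p.1 + E p.2) (fun p => f p.1 * g p.2) := by
  rw [gibbsMean, gibbsMean, gibbsMean, partitionFn_replicas, div_mul_div_comm, ← sq,
    Finset.sum_mul_sum, Fintype.sum_prod_type]
  congr 1
  refine Finset.sum_congr rfl fun s _ => Finset.sum_congr rfl fun s' _ => ?_
  rw [Real.exp_add]
  ring

theorem hasDerivAt_log_partitionFn [Nonempty S] {E : ℝ → S → ℝ} {E' : S → ℝ} {x : ℝ}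
    (hE : ∀ s, HasDerivAt (fun y => E y s) (E' s) x) :
    HasDerivAt (fun y => Real.log (partitionFn (E y))) (gibbsMean (E x) E') x := by
  have hZ : HasDerivAt (fun y => partitionFn (E y)) (∑ s, Real.exp (E x s) * E' s) x :=
    HasDerivAt.fun_sum fun s _ => (hE s).exp
  refine (hZ.log (partitionFn_pos _).ne').congr_deriv ?_
  simp only [gibbsMean, mul_comm]

theorem hasDerivAt_gibbsMean [Nonempty S] {E : ℝ → S → ℝ} {E' : S → ℝ} {x : ℝ} (f : S → ℝ)
    (hE : ∀ s, HasDerivAt (fun y => E y s) (E' s) x) :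
    HasDerivAt (fun y => gibbsMean (E y) f)
      (gibbsMean (E x) (fun s => f s * E' s) - gibbsMean (E x) f * gibbsMean (E x) E') x := by
  have hZ : HasDerivAt (fun y => partitionFn (E y)) (∑ s, Real.exp (E x s) * E' s) x :=
    HasDerivAt.fun_sum fun s _ => (hE s).exp
  have hN : HasDerivAt (fun y => ∑ s, f s * Real.exp (E y s))
      (∑ s, f s * (Real.exp (E x s) * E' s)) x :=
    HasDerivAt.fun_sum fun s _ => (hE s).exp.const_mul (f s)
  have hne := (partitionFn_pos (E x)).ne'
  refine (hN.div hZ hne).congr_deriv ?_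
  have h1 : ∑ s, f s * (Real.exp (E x s) * E' s) = ∑ s, f s * E' s * Real.exp (E x s) :=
    Finset.sum_congr rfl fun s _ => by ring
  have h2 : ∑ s, Real.exp (E x s) * E' s = ∑ s, E' s * Real.exp (E x s) :=
    Finset.sum_congr rfl fun s _ => by ring
  rw [h1, h2, gibbsMean, gibbsMean, gibbsMean]
  field_simp

theorem abs_log_partitionFn_le [Nonempty S] {E : S → ℝ} {B : ℝ} (hB : ∀ s, |E s| ≤ B) :
    |Real.log (partitionFn E)| ≤ Real.log (Fintype.card S) + B := by
  have hcard : (1 : ℝ) ≤ Fintype.card S := by exact_mod_cast Fintype.card_pos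
  have hlog : 0 ≤ Real.log (Fintype.card S) := Real.log_nonneg hcard
  rw [abs_le]
  constructor
  · obtain ⟨s⟩ := ‹Nonempty S›
    have h1 : Real.exp (E s) ≤ partitionFn E :=
      Finset.single_le_sum (f := fun s => Real.exp (E s)) (fun _ _ => (Real.exp_pos _).le)
        (Finset.mem_univ s)
    have h2 := Real.log_le_log (Real.exp_pos _) h1
    rw [Real.log_exp] at h2
    linarith [(abs_le.1 (hB s)).1]
  · have h1 : partitionFn E ≤ Fintype.card S * Real.exp B := by
      have := Finset.sum_le_card_nsmul Finset.univ (fun s => Real.exp (E s)) (Real.exp B)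
        fun s _ => Real.exp_le_exp.2 ((le_abs_self _).trans (hB s))
      simpa [partitionFn] using this
    have h2 := Real.log_le_log (partitionFn_pos E) h1
    rwa [Real.log_mul (by positivity) (Real.exp_pos _).ne', Real.log_exp] at h2

end GibbsMeasure

section GaussianEnergy

variable {ι S : Type*} [Fintype ι]

/-- The energy `∑ k, c k * ω k * v k s`, linear in the disorder `ω`, with amplitudes `c`. -/
noncomputable def linearEnergy (v : ι → S → ℝ) (c ω : ι → ℝ) (s : S) : ℝ :=
  ∑ k, c k * ω k * v k s

theorem continuous_linearEnergy (v : ι → S → ℝ) :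
    Continuous fun p : (ι → ℝ) × (ι → ℝ) => linearEnergy v p.1 p.2 := by
  unfold linearEnergy
  fun_prop

theorem abs_linearEnergy_le {v : ι → S → ℝ} (hv : ∀ k s, |v k s| ≤ 1) {c C : ι → ℝ}
    (hc : ∀ k, |c k| ≤ C k) (ω : ι → ℝ) (s : S) :
    |linearEnergy v c ω s| ≤ ∑ k, C k * |ω k| := by
  refine (Finset.abs_sum_le_sum_abs _ _).trans (Finset.sum_le_sum fun k _ => ?_)
  rw [abs_mul, abs_mul]
  calc |c k| * |ω k| * |v k s| ≤ |c k| * |ω k| * 1 := by gcongr; exact hv k s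
    _ ≤ C k * |ω k| := by rw [mul_one]; gcongr; exact hc k

theorem hasDerivAt_linearEnergy (v : ι → S → ℝ) {c : ℝ → ι → ℝ} {c' : ι → ℝ} {x : ℝ}
    (hc : ∀ k, HasDerivAt (fun y => c y k) (c' k) x) (ω : ι → ℝ) (s : S) :
    HasDerivAt (fun y => linearEnergy v (c y) ω s) (linearEnergy v c' ω s) x :=
  HasDerivAt.fun_sum fun k _ => ((hc k).mul_const (ω k)).mul_const (v k s)

theorem hasDerivAt_linearEnergy_update [DecidableEq ι] (v : ι → S → ℝ) (c ω : ι → ℝ) (k : ι)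
    (s : S) (x : ℝ) :
    HasDerivAt (fun y => linearEnergy v c (Function.update ω k y) s) (c k * v k s) x := by
  have h : ∀ y, linearEnergy v c (Function.update ω k y) s
      = c k * v k s * y + ∑ l ∈ Finset.univ.erase k, c l * ω l * v l s := by
    intro y
    rw [linearEnergy, ← Finset.add_sum_erase _ _ (Finset.mem_univ k), Function.update_self]
    congr 1
    · ring
    · exact Finset.sum_congr rfl fun l hl => by
        rw [Function.update_of_ne (Finset.ne_of_mem_erase hl)]
  simp only [h]
  refine (((hasDerivAt_id x).const_mul (c k * v k s)).add_const
    (∑ l ∈ Finset.univ.erase k, c l * ω l * v l s)).congr_deriv (mul_one _)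

theorem integrable_sum_mul_abs_eval (C : ι → ℝ) :
    Integrable (fun ω : ι → ℝ => ∑ k, C k * |ω k|) (Measure.pi fun _ => gaussianReal 0 1) :=
  integrable_finsetSum _ fun k _ => (integrable_eval_pi_gaussianReal k).abs.const_mul (C k)

variable [Fintype S] [Nonempty S]

theorem continuous_log_partitionFn_linearEnergy (v : ι → S → ℝ) :
    Continuous fun p : (ι → ℝ) × (ι → ℝ) => Real.log (partitionFn (linearEnergy v p.1 p.2)) :=
  (continuous_partitionFn.comp (continuous_linearEnergy v)).log fun _ => (partitionFn_pos _).ne'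

/-- Gaussian integration by parts for a Gibbs average of the coefficient of `ω k`. -/
theorem integral_eval_mul_gibbsMean_linearEnergy {v : ι → S → ℝ} (hv : ∀ k s, v k s ^ 2 = 1)
    (c : ι → ℝ) (k : ι) :
    ∫ ω, ω k * gibbsMean (linearEnergy v c ω) (v k) ∂(Measure.pi fun _ => gaussianReal 0 1)
      = ∫ ω, c k * (1 - gibbsMean (linearEnergy v c ω) (v k) ^ 2)
          ∂(Measure.pi fun _ => gaussianReal 0 1) := by
  classical
  have hcont : Continuous fun ω => gibbsMean (linearEnergy v c ω) (v k) :=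
    (continuous_gibbsMean (v k)).comp
      ((continuous_linearEnergy v).comp (continuous_const.prodMk continuous_id))
  have hbd : ∀ ω, |gibbsMean (linearEnergy v c ω) (v k)| ≤ 1 := fun ω =>
    abs_gibbsMean_le fun s => (sq_le_one_iff_abs_le_one _).1 (hv k s).le
  refine integral_eval_mul_pi_gaussianReal k (C := 1) (D := |c k|) (fun ω x => ?_)
    hcont.measurable (Continuous.measurable (by fun_prop)) hbd fun ω => ?_
  · refine (hasDerivAt_gibbsMean (v k)
      fun s => hasDerivAt_linearEnergy_update v c ω k s x).congr_deriv ?_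
    have h1 : (fun s => v k s * (c k * v k s)) = fun _ => c k := by
      ext s
      linear_combination c k * hv k s
    rw [h1, gibbsMean_const, gibbsMean_const_mul]
    ring
  · rw [abs_mul]
    refine mul_le_of_le_one_right (abs_nonneg _) ?_
    have h := sq_abs (gibbsMean (linearEnergy v c ω) (v k)) ▸
      pow_le_one₀ (n := 2) (abs_nonneg _) (hbd ω)
    rw [abs_le]
    constructor <;> nlinarith [sq_nonneg (gibbsMean (linearEnergy v c ω) (v k))]

/-- Derivative of the quenched pressure along a path of amplitudes. -/
theorem hasDerivAt_integral_log_partitionFn {v : ι → S → ℝ} (hv : ∀ k s, v k s ^ 2 = 1)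
    {c c' : ℝ → ι → ℝ} {t : ℝ} (hc : ∀ᶠ x in 𝓝 t, ∀ k, HasDerivAt (fun y => c y k) (c' x k) x)
    (hc' : ContinuousAt c' t) :
    HasDerivAt
      (fun x => ∫ ω, Real.log (partitionFn (linearEnergy v (c x) ω))
        ∂(Measure.pi fun _ => gaussianReal 0 1))
      (∫ ω, ∑ k, c t k * c' t k * (1 - gibbsMean (linearEnergy v (c t) ω) (v k) ^ 2)
        ∂(Measure.pi fun _ => gaussianReal 0 1)) t := by
  have hv1 : ∀ k s, |v k s| ≤ 1 := fun k s =>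
    (sq_le_one_iff_abs_le_one _).1 (hv k s).le
  have hev : ∀ᶠ x in 𝓝 t, ∀ k, |c' x k| ≤ |c' t k| + 1 := by
    refine eventually_all.2 fun k => ?_
    have h : ContinuousAt (fun x => |c' x k|) t := (continuousAt_pi.1 hc' k).abs
    exact (h.eventually_lt_const (lt_add_one |c' t k|)).mono fun _ hx => hx.le
  have hmeas : ∀ a : ι → ℝ, Continuous fun ω => Real.log (partitionFn (linearEnergy v a ω)) :=
    fun a => (continuous_log_partitionFn_linearEnergy v).comp (continuous_const.prodMk continuous_id)
  have hE : Continuous fun ω => linearEnergy v (c t) ω :=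
    (continuous_linearEnergy v).comp (continuous_const.prodMk continuous_id)
  have hmean : ∀ k, Continuous fun ω => gibbsMean (linearEnergy v (c t) ω) (v k) :=
    fun k => (continuous_gibbsMean (v k)).comp hE
  have hbd : ∀ k ω, |gibbsMean (linearEnergy v (c t) ω) (v k)| ≤ 1 :=
    fun k ω => abs_gibbsMean_le (hv1 k)
  have hexp : ∀ a ω, gibbsMean (linearEnergy v (c t) ω) (linearEnergy v a ω)
      = ∑ k, a k * (ω k * gibbsMean (linearEnergy v (c t) ω) (v k)) := by
    intro a ω
    unfold linearEnergy
    rw [gibbsMean_sum]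
    simp only [gibbsMean_const_mul, mul_assoc]
  have hdom := (hasDerivAt_integral_of_dominated_loc_of_deriv_le
    (μ := Measure.pi fun _ : ι => gaussianReal 0 1)
    (F := fun x ω => Real.log (partitionFn (linearEnergy v (c x) ω)))
    (F' := fun x ω => gibbsMean (linearEnergy v (c x) ω) (linearEnergy v (c' x) ω))
    (bound := fun ω => ∑ k, (|c' t k| + 1) * |ω k|)
    (hc.and hev) (Eventually.of_forall fun x => (hmeas _).aestronglyMeasurable)
    (((integrable_const _).add (integrable_sum_mul_abs_eval fun k => |c t k|)).mono'
      (hmeas _).aestronglyMeasurable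
      (ae_of_all _ fun ω => abs_log_partitionFn_le
        (abs_linearEnergy_le hv1 (fun k => le_rfl) ω)))
    (by
      simp only [hexp]
      exact Continuous.aestronglyMeasurable (by fun_prop))
    (ae_of_all _ fun ω x hx => abs_gibbsMean_le (abs_linearEnergy_le hv1 hx.2 ω))
    (integrable_sum_mul_abs_eval _)
    (ae_of_all _ fun ω x hx => hasDerivAt_log_partitionFn
      (hasDerivAt_linearEnergy v hx.1 ω))).2
  refine hdom.congr_deriv ?_
  simp only [hexp]
  have hint : ∀ k, Integrable (fun ω : ι → ℝ => ω k * gibbsMean (linearEnergy v (c t) ω) (v k))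
      (Measure.pi fun _ => gaussianReal 0 1) := fun k =>
    integrable_mul_of_bounded (integrable_eval_pi_gaussianReal k) (hmean k).measurable (hbd k)
  have hint' : ∀ k, Integrable
      (fun ω : ι → ℝ => c t k * c' t k * (1 - gibbsMean (linearEnergy v (c t) ω) (v k) ^ 2))
      (Measure.pi fun _ => gaussianReal 0 1) := by
    intro k
    refine ((integrable_const (1 : ℝ)).sub ?_).const_mul _
    refine Integrable.of_bound ((hmean k).pow 2).aestronglyMeasurable 1 (ae_of_all _ fun ω => ?_)
    rw [norm_pow]
    exact pow_le_one₀ (norm_nonneg _) (hbd k ω)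
  rw [integral_finsetSum _ fun k _ => (hint k).const_mul _,
    integral_finsetSum _ fun k _ => hint' k]
  refine Finset.sum_congr rfl fun k _ => ?_
  rw [integral_const_mul, integral_eval_mul_gibbsMean_linearEnergy hv, ← integral_const_mul]
  congr 1 with ω
  ring

theorem continuousOn_integral_log_partitionFn {v : ι → S → ℝ} (hv : ∀ k s, |v k s| ≤ 1)
    {c : ℝ → ι → ℝ} (hc : Continuous c) {A : Set ℝ} {C : ι → ℝ}
    (hC : ∀ x ∈ A, ∀ k, |c x k| ≤ C k) :
    ContinuousOn (fun x => ∫ ω, Real.log (partitionFn (linearEnergy v (c x) ω))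
      ∂(Measure.pi fun _ => gaussianReal 0 1)) A := by
  have hcont := continuous_log_partitionFn_linearEnergy v
  refine continuousOn_of_dominated
    (bound := fun ω => Real.log (Fintype.card S) + ∑ k, C k * |ω k|)
    (fun x _ => (hcont.comp (continuous_const.prodMk continuous_id)).aestronglyMeasurable)
    (fun x hx => ae_of_all _ fun ω => abs_log_partitionFn_le (abs_linearEnergy_le hv (hC x hx) ω))
    ((integrable_const _).add (integrable_sum_mul_abs_eval C))
    (ae_of_all _ fun ω => (hcont.comp (hc.prodMk continuous_const)).continuousOn)

theorem continuous_gibbsMean_replicas (v : ι → S → ℝ) (f : S × S → ℝ) :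
    Continuous fun q : (ι → ℝ) × (ι → ℝ) => gibbsMean (fun p : S × S =>
      linearEnergy v q.1 q.2 p.1 + linearEnergy v q.1 q.2 p.2) f := by
  have h := continuous_pi_iff.1 (continuous_linearEnergy v)
  have hE : Continuous fun (q : (ι → ℝ) × (ι → ℝ)) (p : S × S) =>
      linearEnergy v q.1 q.2 p.1 + linearEnergy v q.1 q.2 p.2 :=
    continuous_pi fun p => (h p.1).add (h p.2)
  exact (continuous_gibbsMean f).comp hE

theorem integrable_gibbsMean_replicas (v : ι → S → ℝ) (c : ι → ℝ) (f : S × S → ℝ) :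
    Integrable (fun ω => gibbsMean (fun p : S × S =>
        linearEnergy v c ω p.1 + linearEnergy v c ω p.2) f)
      (Measure.pi fun _ => gaussianReal 0 1) :=
  Integrable.of_bound ((continuous_gibbsMean_replicas v f).comp
      (continuous_const.prodMk continuous_id)).aestronglyMeasurable (∑ p, |f p|)
    (ae_of_all _ fun _ => abs_gibbsMean_le (abs_le_sum_abs f))

theorem continuous_integral_gibbsMean_replicas (v : ι → S → ℝ) {c : ℝ → ι → ℝ}
    (hc : Continuous c) (f : S × S → ℝ) :
    Continuous fun x => ∫ ω, gibbsMean (fun p : S × S =>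
        linearEnergy v (c x) ω p.1 + linearEnergy v (c x) ω p.2) f
      ∂(Measure.pi fun _ => gaussianReal 0 1) := by
  have hcont : ∀ ω, Continuous fun x => gibbsMean (fun p : S × S =>
      linearEnergy v (c x) ω p.1 + linearEnergy v (c x) ω p.2) f := by
    intro ω
    have h := (continuous_gibbsMean_replicas v f).comp
      (hc.prodMk (continuous_const (y := ω)))
    exact h
  exact continuous_of_dominated (bound := fun _ => ∑ p, |f p|)
    (fun x => (integrable_gibbsMean_replicas v (c x) f).aestronglyMeasurable)
    (fun x => ae_of_all _ fun ω => abs_gibbsMean_le (abs_le_sum_abs f))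
    (integrable_const _) (ae_of_all _ hcont)

end GaussianEnergy

section BipartiteSpinGlass

theorem spin_sq (b : Bool) : spin b ^ 2 = 1 := by
  cases b <;> simp [spin]

/-- Coefficient of each disorder variable in the energy of a bipartite configuration. -/
noncomputable def bipartiteCoeff (N₁ N₂ : ℕ) (k : DisIdx N₁ N₂)
    (s : (Fin N₁ → Bool) × (Fin N₂ → Bool)) : ℝ :=
  match k with
  | Sum.inl (i, j) => spin (s.1 i) * spin (s.2 j)
  | Sum.inr (Sum.inl i) => spin (s.1 i)
  | Sum.inr (Sum.inr j) => spin (s.2 j)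

/-- Couplings at full strength. -/
noncomputable def bipartiteAmp (N₁ N₂ : ℕ) (β qbar pbar : ℝ) : DisIdx N₁ N₂ → ℝ
  | Sum.inl _ => β * √(2 / ((N₁ : ℝ) + N₂))
  | Sum.inr (Sum.inl _) => β * √(2 * (1 - (N₁ : ℝ) / ((N₁ : ℝ) + N₂)) * pbar)
  | Sum.inr (Sum.inr _) => β * √(2 * ((N₁ : ℝ) / ((N₁ : ℝ) + N₂)) * qbar)

/-- Interpolation weight of each disorder variable. -/
noncomputable def interpWeight (N₁ N₂ : ℕ) (t : ℝ) : DisIdx N₁ N₂ → ℝ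
  | Sum.inl _ => √t
  | Sum.inr _ => √(1 - t)

/-- Derivative in `t` of `interpWeight`. -/
noncomputable def interpWeightDeriv (N₁ N₂ : ℕ) (t : ℝ) : DisIdx N₁ N₂ → ℝ
  | Sum.inl _ => 1 / (2 * √t)
  | Sum.inr _ => -1 / (2 * √(1 - t))

variable {N₁ N₂ : ℕ}

theorem bipartiteCoeff_sq (k : DisIdx N₁ N₂) (s : (Fin N₁ → Bool) × (Fin N₂ → Bool)) :
    bipartiteCoeff N₁ N₂ k s ^ 2 = 1 := by
  rcases k with ⟨i, j⟩ | i | j <;> simp [bipartiteCoeff, mul_pow, spin_sq]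

theorem continuous_interpWeight : Continuous (interpWeight N₁ N₂) := by
  refine continuous_pi fun k => ?_
  rcases k with k | k <;> simp only [interpWeight] <;> fun_prop

theorem abs_interpWeight_le_one {t : ℝ} (ht : t ∈ Set.Icc (0 : ℝ) 1) (k : DisIdx N₁ N₂) :
    |interpWeight N₁ N₂ t k| ≤ 1 := by
  rcases k with k | k <;>
    simp only [interpWeight, abs_of_nonneg (Real.sqrt_nonneg _)] <;>
    rw [Real.sqrt_le_one] <;> linarith [ht.1, ht.2]

theorem hasDerivAt_interpWeight {t : ℝ} (ht : t ∈ Set.Ioo (0 : ℝ) 1) (k : DisIdx N₁ N₂) :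
    HasDerivAt (fun x => interpWeight N₁ N₂ x k) (interpWeightDeriv N₁ N₂ t k) t := by
  rcases k with k | k
  · exact Real.hasDerivAt_sqrt ht.1.ne'
  · exact ((hasDerivAt_id t).const_sub 1).sqrt (sub_pos.2 ht.2).ne'

theorem continuousAt_interpWeightDeriv {t : ℝ} (ht : t ∈ Set.Ioo (0 : ℝ) 1) :
    ContinuousAt (interpWeightDeriv N₁ N₂) t := by
  have h0 : 2 * √t ≠ 0 := by have := Real.sqrt_pos.2 ht.1; positivity
  have h1 : 2 * √(1 - t) ≠ 0 := by have := Real.sqrt_pos.2 (sub_pos.2 ht.2); positivity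
  refine continuousAt_pi.2 fun k => ?_
  rcases k with k | k <;> simp only [interpWeightDeriv] <;>
    exact ContinuousAt.div (by fun_prop) (by fun_prop) (by assumption)

theorem interpExp_eq_linearEnergy (β qbar pbar t : ℝ) (ω : DisIdx N₁ N₂ → ℝ)
    (s : (Fin N₁ → Bool) × (Fin N₂ → Bool)) :
    interpExp N₁ N₂ β qbar pbar t ω s.1 s.2
      = linearEnergy (bipartiteCoeff N₁ N₂)
          (fun k => interpWeight N₁ N₂ t k * bipartiteAmp N₁ N₂ β qbar pbar k) ω s := by
  rw [interpExp, linearEnergy, Fintype.sum_sum_type, Fintype.sum_sum_type, Fintype.sum_prod_type]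
  simp only [bipartiteCoeff, interpWeight, bipartiteAmp, mul_add, Finset.mul_sum]
  congr 1
  · exact Finset.sum_congr rfl fun i _ => Finset.sum_congr rfl fun j _ => by ring
  · congr 1 <;> exact Finset.sum_congr rfl fun i _ => by ring

theorem interpZ_eq_partitionFn (β qbar pbar t : ℝ) (ω : DisIdx N₁ N₂ → ℝ) :
    interpZ N₁ N₂ β qbar pbar t ω
      = partitionFn (linearEnergy (bipartiteCoeff N₁ N₂)
          (fun k => interpWeight N₁ N₂ t k * bipartiteAmp N₁ N₂ β qbar pbar k) ω) := by
  simp only [interpZ, partitionFn, ← interpExp_eq_linearEnergy, Fintype.sum_prod_type]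

theorem fluctGibbs_eq_gibbsMean (β qbar pbar t : ℝ) (ω : DisIdx N₁ N₂ → ℝ) :
    fluctGibbs N₁ N₂ β qbar pbar t ω
      = gibbsMean (fun p : ((Fin N₁ → Bool) × (Fin N₂ → Bool)) ×
            ((Fin N₁ → Bool) × (Fin N₂ → Bool)) =>
          linearEnergy (bipartiteCoeff N₁ N₂)
              (fun k => interpWeight N₁ N₂ t k * bipartiteAmp N₁ N₂ β qbar pbar k) ω p.1
            + linearEnergy (bipartiteCoeff N₁ N₂)
              (fun k => interpWeight N₁ N₂ t k * bipartiteAmp N₁ N₂ β qbar pbar k) ω p.2)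
          (fun p => (qbar - overlap p.1.1 p.2.1) * (pbar - overlap p.1.2 p.2.2)) := by
  rw [gibbsMean, partitionFn_replicas, ← interpZ_eq_partitionFn]
  simp only [fluctGibbs, ← interpExp_eq_linearEnergy, Fintype.sum_prod_type]

theorem sum_spin_mul_spin {K : ℕ} (hK : 1 ≤ K) (σ σ' : Fin K → Bool) :
    ∑ i, spin (σ i) * spin (σ' i) = K * overlap σ σ' := by
  have : (K : ℝ) ≠ 0 := by positivity
  rw [overlap]
  field_simp

/-- The covariance identity behind the sum rule: completing the product `(q̄ - q₁₂)(p̄ - p₁₂)`. -/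
theorem sum_interpWeight_mul_deriv (hN₁ : 1 ≤ N₁) (hN₂ : 1 ≤ N₂) {β qbar pbar t : ℝ}
    (hq : 0 ≤ qbar) (hp : 0 ≤ pbar) (ht : t ∈ Set.Ioo (0 : ℝ) 1)
    (s s' : (Fin N₁ → Bool) × (Fin N₂ → Bool)) :
    ∑ k, interpWeight N₁ N₂ t k * bipartiteAmp N₁ N₂ β qbar pbar k *
        (interpWeightDeriv N₁ N₂ t k * bipartiteAmp N₁ N₂ β qbar pbar k) *
        (1 - bipartiteCoeff N₁ N₂ k s * bipartiteCoeff N₁ N₂ k s')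
      = ((N₁ : ℝ) + N₂) * (((N₁ : ℝ) / ((N₁ : ℝ) + N₂)) * (1 - (N₁ : ℝ) / ((N₁ : ℝ) + N₂)) *
          β ^ 2 * ((1 - qbar) * (1 - pbar)
            - (qbar - overlap s.1 s'.1) * (pbar - overlap s.2 s'.2))) := by
  have hN₁' : (0 : ℝ) < N₁ := by exact_mod_cast hN₁
  have hN₂' : (0 : ℝ) < N₂ := by exact_mod_cast hN₂
  have hα : 1 - (N₁ : ℝ) / ((N₁ : ℝ) + N₂) = N₂ / ((N₁ : ℝ) + N₂) := by field_simp; ring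
  have ht0 := Real.sqrt_pos.2 ht.1
  have ht1 := Real.sqrt_pos.2 (sub_pos.2 ht.2)
  have h0 : √t * (1 / (2 * √t)) = 1 / 2 := by field_simp
  have h1 : √(1 - t) * (-1 / (2 * √(1 - t))) = -(1 / 2) := by field_simp
  have e0 := Real.sq_sqrt (show 0 ≤ 2 / ((N₁ : ℝ) + N₂) by positivity)
  have e1 := Real.sq_sqrt (show 0 ≤ 2 * ((N₂ : ℝ) / ((N₁ : ℝ) + N₂)) * pbar by positivity)
  have e2 := Real.sq_sqrt (show 0 ≤ 2 * ((N₁ : ℝ) / ((N₁ : ℝ) + N₂)) * qbar by positivity)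
  have hq12 := sum_spin_mul_spin hN₁ s.1 s'.1
  have hp12 := sum_spin_mul_spin hN₂ s.2 s'.2
  have c0 : ∀ x w d : ℝ, w * (β * x) * (d * (β * x)) = w * d * β ^ 2 * x ^ 2 := by
    intros; ring
  have hprod : ∑ i : Fin N₁, ∑ j : Fin N₂,
      spin (s.1 i) * spin (s.2 j) * (spin (s'.1 i) * spin (s'.2 j))
      = N₁ * overlap s.1 s'.1 * (N₂ * overlap s.2 s'.2) := by
    rw [← hq12, ← hp12, Finset.sum_mul_sum]
    exact Finset.sum_congr rfl fun i _ => Finset.sum_congr rfl fun j _ => by ring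
  rw [Fintype.sum_sum_type, Fintype.sum_sum_type, Fintype.sum_prod_type]
  simp only [bipartiteCoeff, interpWeight, interpWeightDeriv, bipartiteAmp, c0, hα, h0, h1, e0, e1,
    e2, ← Finset.mul_sum, Finset.sum_sub_distrib, hprod, hq12, hp12, Finset.sum_const,
    Finset.card_univ, Fintype.card_fin, nsmul_eq_mul, mul_one]
  field_simp
  ring

end BipartiteSpinGlass

theorem bipartite_SG_sum_rule (N₁ N₂ : ℕ) (hN₁ : 1 ≤ N₁) (hN₂ : 1 ≤ N₂)
    (β qbar pbar : ℝ) (hβ : 0 < β)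
    (hq : qbar ∈ Set.Icc (0 : ℝ) 1) (hp : pbar ∈ Set.Icc (0 : ℝ) 1) :
    let α : ℝ := (N₁ : ℝ) / ((N₁ : ℝ) + N₂)
    (∀ t ∈ Set.Ioo (0 : ℝ) 1,
        HasDerivAt (interpA N₁ N₂ β qbar pbar)
          (-(α * (1 - α) * β ^ 2) *
            ∫ ω, fluctGibbs N₁ N₂ β qbar pbar t ω ∂(disMeasure N₁ N₂)) t) ∧
    interpA N₁ N₂ β qbar pbar 1
      = interpA N₁ N₂ β qbar pbar 0
        - α * (1 - α) * β ^ 2 *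
          ∫ t in (0 : ℝ)..1,
            ∫ ω, fluctGibbs N₁ N₂ β qbar pbar t ω ∂(disMeasure N₁ N₂) := by
  intro α
  have hv := bipartiteCoeff_sq (N₁ := N₁) (N₂ := N₂)
  have hv1 : ∀ k s, |bipartiteCoeff N₁ N₂ k s| ≤ 1 := fun k s =>
    (sq_le_one_iff_abs_le_one _).1 (hv k s).le
  set a := bipartiteAmp N₁ N₂ β qbar pbar
  have hc : Continuous fun x k => interpWeight N₁ N₂ x k * a k :=
    continuous_pi fun k => (continuous_pi_iff.1 continuous_interpWeight k).mul_const _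
  have hN : (0 : ℝ) < (N₁ : ℝ) + N₂ := by positivity
  have hA : interpA N₁ N₂ β qbar pbar = fun t =>
      (1 / ((N₁ : ℝ) + N₂)) * ∫ ω, Real.log (partitionFn (linearEnergy (bipartiteCoeff N₁ N₂)
        (fun k => interpWeight N₁ N₂ t k * a k) ω)) ∂(Measure.pi fun _ => gaussianReal 0 1)
      + (1 - t) * α * (1 - α) * β ^ 2 * (1 - qbar) * (1 - pbar) := by
    ext t
    simp only [interpA, interpZ_eq_partitionFn, disMeasure, a, α]
  have hfluct : ∀ t, Integrable (fluctGibbs N₁ N₂ β qbar pbar t) (disMeasure N₁ N₂) := by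
    intro t
    rw [funext (fluctGibbs_eq_gibbsMean β qbar pbar t)]
    exact integrable_gibbsMean_replicas _ _ _
  have hderiv : ∀ t ∈ Set.Ioo (0 : ℝ) 1, HasDerivAt (interpA N₁ N₂ β qbar pbar)
      (-(α * (1 - α) * β ^ 2) * ∫ ω, fluctGibbs N₁ N₂ β qbar pbar t ω ∂(disMeasure N₁ N₂)) t := by
    intro t ht
    have hd := hasDerivAt_integral_log_partitionFn hv
      (c := fun x k => interpWeight N₁ N₂ x k * a k)
      (c' := fun x k => interpWeightDeriv N₁ N₂ x k * a k) (t := t)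
      (by
        filter_upwards [isOpen_Ioo.mem_nhds ht] with x hx k
        exact (hasDerivAt_interpWeight hx k).mul_const (a k))
      (continuousAt_pi.2 fun k =>
        (continuousAt_pi.1 (continuousAt_interpWeightDeriv ht) k).mul_const (a k))
    have hlin : HasDerivAt (fun x : ℝ => (1 - x) * α * (1 - α) * β ^ 2 * (1 - qbar) * (1 - pbar))
        (-1 * α * (1 - α) * β ^ 2 * (1 - qbar) * (1 - pbar)) t :=
      ((((((hasDerivAt_id t).const_sub 1).mul_const α).mul_const (1 - α)).mul_const
        (β ^ 2)).mul_const (1 - qbar)).mul_const (1 - pbar)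
    rw [hA]
    refine ((hd.const_mul (1 / ((N₁ : ℝ) + N₂))).add hlin).congr_deriv ?_
    have hpt : ∀ ω, ∑ k, interpWeight N₁ N₂ t k * a k * (interpWeightDeriv N₁ N₂ t k * a k) *
          (1 - gibbsMean (linearEnergy (bipartiteCoeff N₁ N₂)
            (fun k => interpWeight N₁ N₂ t k * a k) ω) (bipartiteCoeff N₁ N₂ k) ^ 2)
        = ((N₁ : ℝ) + N₂) * (α * (1 - α) * β ^ 2 * ((1 - qbar) * (1 - pbar)
            + -1 * fluctGibbs N₁ N₂ β qbar pbar t ω)) := by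
      intro ω
      rw [fluctGibbs_eq_gibbsMean]
      set E := linearEnergy (bipartiteCoeff N₁ N₂) (fun k => interpWeight N₁ N₂ t k * a k) ω
      have h1 : ∀ k, 1 - gibbsMean E (bipartiteCoeff N₁ N₂ k) ^ 2
          = gibbsMean (fun p : _ × _ => E p.1 + E p.2)
            (fun p => 1 + -1 * (bipartiteCoeff N₁ N₂ k p.1 * bipartiteCoeff N₁ N₂ k p.2)) := by
        intro k
        rw [gibbsMean_add, gibbsMean_const, gibbsMean_const_mul, ← gibbsMean_mul_gibbsMean]
        ring
      simp only [h1]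
      rw [← gibbsMean_const_mul, ← gibbsMean_const (fun p : _ × _ => E p.1 + E p.2)
        ((1 - qbar) * (1 - pbar)), ← gibbsMean_add, ← gibbsMean_const_mul, ← gibbsMean_const_mul]
      simp only [← gibbsMean_const_mul, ← gibbsMean_sum]
      congr 1 with p
      have := sum_interpWeight_mul_deriv hN₁ hN₂ (β := β) hq.1 hp.1 ht p.1 p.2
      simp only [neg_one_mul, ← sub_eq_add_neg]
      exact this
    simp only [hpt]
    have hsplit : ∫ ω, ((N₁ : ℝ) + N₂) * (α * (1 - α) * β ^ 2 * ((1 - qbar) * (1 - pbar)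
          + -1 * fluctGibbs N₁ N₂ β qbar pbar t ω)) ∂(disMeasure N₁ N₂)
        = ((N₁ : ℝ) + N₂) * (α * (1 - α) * β ^ 2 * ((1 - qbar) * (1 - pbar)
          + -1 * ∫ ω, fluctGibbs N₁ N₂ β qbar pbar t ω ∂(disMeasure N₁ N₂))) := by
      have : IsProbabilityMeasure (disMeasure N₁ N₂) := by unfold disMeasure; infer_instance
      rw [integral_const_mul, integral_const_mul,
        integral_add (integrable_const _) ((hfluct t).const_mul _),
        integral_const, probReal_univ, one_smul, integral_const_mul]
    rw [show (Measure.pi fun _ => gaussianReal 0 1) = disMeasure N₁ N₂ from rfl, hsplit]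
    field_simp
    ring
  have hcontF : Continuous fun t =>
      ∫ ω, fluctGibbs N₁ N₂ β qbar pbar t ω ∂(disMeasure N₁ N₂) := by
    simp only [fluctGibbs_eq_gibbsMean]
    exact continuous_integral_gibbsMean_replicas _ hc _
  have hcontA : ContinuousOn (interpA N₁ N₂ β qbar pbar) (Set.Icc 0 1) := by
    rw [hA]
    refine (continuousOn_const.mul (continuousOn_integral_log_partitionFn hv1 hc
      (C := fun k => |a k|) fun x hx k => ?_)).add (Continuous.continuousOn (by fun_prop))
    rw [abs_mul]
    exact mul_le_of_le_one_left (abs_nonneg _) (abs_interpWeight_le_one hx k)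
  refine ⟨hderiv, ?_⟩
  have h := intervalIntegral.integral_eq_sub_of_hasDerivAt_of_le zero_le_one hcontA hderiv
    ((hcontF.const_mul _).intervalIntegrable _ _)
  rw [intervalIntegral.integral_const_mul] at h
  linarith
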